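/- Let μ, ν ∈ ℝ with φ(μ) ≠ 0, 14 − 3μ ≠ 0, ν ≠ 0, and ν = 3·(5−μ)·(4−μ)·(3−μ)·μ/(14 − 3μ) (the spectral decimation relation for SG₃). If x, x' ∈ ℝ satisfy x' = 1 − α(μ) − δ(μ) + δ(μ)·x, then x' − μ/4 = ((4−μ)·(6−μ)·μ/((4 − 6μ + μ²)·ν)) · (x − ν/4). -/

import Mathlib

/-- `φ(λ) = 3(5−λ)(3−λ)(4−6λ+λ²)` for `SG₃`. -/
noncomputable def phiSG3 (l : ℝ) : ℝ := 3 * (5 - l) * (3 - l) * (4 - 6*l + l^2)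

/-- `α(λ) = (96 − 109λ + 33λ² − 3λ³)/φ(λ)`. -/
noncomputable def alphaSG3 (l : ℝ) : ℝ := (96 - 109*l + 33*l^2 - 3*l^3) / phiSG3 l

/-- `δ(λ) = (14 − 3λ)(6 − λ)/φ(λ)`. -/
noncomputable def deltaSG3 (l : ℝ) : ℝ := (14 - 3*l) * (6 - l) / phiSG3 l

/-- One step of the `SG₃` spectral-decimation recursion in normalized form. -/
theorem sg3_recursion_step (mu nu : ℝ)
    (hphi : phiSG3 mu ≠ 0) (h14 : 14 - 3*mu ≠ 0) (hnu : nu ≠ 0)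
    (hrel : nu = 3 * (5 - mu) * (4 - mu) * (3 - mu) * mu / (14 - 3*mu))
    (x x' : ℝ)
    (hx : x' = 1 - alphaSG3 mu - deltaSG3 mu + deltaSG3 mu * x) :
    x' - mu/4 = ((4 - mu) * (6 - mu) * mu / ((4 - 6*mu + mu^2) * nu)) * (x - nu/4) := by
  have hq : 4 - 6*mu + mu^2 ≠ 0 := by
    intro h; exact hphi (by simp [phiSG3, h])
  have h5 : 5 - mu ≠ 0 := by
    intro h; exact hphi (by simp [phiSG3, h])
  have h3 : 3 - mu ≠ 0 := by
    intro h; exact hphi (by simp [phiSG3, h])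
  have hmul : nu * (14 - 3*mu) = 3 * (5 - mu) * (4 - mu) * (3 - mu) * mu := by
    rw [hrel, div_mul_cancel₀ _ h14]
  have hcoef : (4 - mu) * (6 - mu) * mu / ((4 - 6*mu + mu^2) * nu) = deltaSG3 mu := by
    rw [deltaSG3, div_eq_div_iff (mul_ne_zero hq hnu) hphi, phiSG3]
    linear_combination (-(6 - mu) * (4 - 6*mu + mu^2)) * hmul
  have hconst : 1 - alphaSG3 mu - deltaSG3 mu - mu/4 = -(deltaSG3 mu * (nu/4)) := by
    rw [alphaSG3, deltaSG3]
    field_simp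
    rw [phiSG3]
    linear_combination (6 - mu) * hmul
  rw [hcoef, hx]
  linear_combination hconst
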